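/- arXiv:1011.2550 — 2 statements merged into one kernel-verified Lean document; each statement's English description precedes it below -/
import Mathlib

section
/- Let φ : ℝ → ℝ be an orientation-preserving diffeomorphism with φ(0) = 0 and φ'(0) = 1, let φ⁻¹ denote its inverse diffeomorphism, and set a_k(φ) := φ⁽ᵏ⁾(0)/k! (so a₁(φ) = 1). Then for every n ≥ 1: a_{n+1}(φ⁻¹) = Σ_{(c₁,…,c_{n+1}) ∈ Λ} (−1)^{n−c₁} · ((2n−c₁)!·c₁!)/((n+1)!·c₁!·c₂!⋯c_{n+1}!) · a₁(φ)^{c₁}·a₂(φ)^{c₂}⋯a_{n+1}(φ)^{c_{n+1}}, where Λ = {(c₁,…,c_{n+1}) ∈ ℕ^{n+1} : Σ_{j=1}^{n+1} c_j = n and Σ_{j=1}^{n+1} j·c_j = 2n}. -/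
/-- An orientation-preserving diffeomorphism of the real line: a smooth map with a
smooth (two-sided) inverse whose derivative is everywhere positive. -/
def IsOPDiffeo (Φ : ℝ → ℝ) : Prop :=
  ContDiff ℝ (⊤ : ℕ∞) Φ ∧
    (∃ Ψ : ℝ → ℝ, ContDiff ℝ (⊤ : ℕ∞) Ψ ∧ Function.LeftInverse Ψ Φ ∧ Function.RightInverse Ψ Φ) ∧
    ∀ x, 0 < deriv Φ x

/-- The Taylor series at `0` of a function `f : ℝ → ℝ`. -/
noncomputable def taylorSeries (f : ℝ → ℝ) : PowerSeries ℝ :=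
  PowerSeries.mk fun n => iteratedDeriv n f 0 / (n.factorial : ℝ)

namespace taylorSeries

open PowerSeries

variable {f g : ℝ → ℝ}

@[simp]
lemma coeff_eq (f : ℝ → ℝ) (n : ℕ) :
    coeff n (taylorSeries f) = iteratedDeriv n f 0 / (n.factorial : ℝ) := by
  simp [taylorSeries]

lemma const (c : ℝ) : taylorSeries (fun _ => c) = C c := by
  ext n
  cases n <;> simp [iteratedDeriv_const, coeff_C]

lemma deriv (f : ℝ → ℝ) : taylorSeries (_root_.deriv f) = d⁄dX ℝ (taylorSeries f) := by
  ext n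
  rw [coeff_derivative, coeff_eq, coeff_eq, iteratedDeriv_succ', Nat.factorial_succ]
  have : (n.factorial : ℝ) ≠ 0 := by positivity
  push_cast
  field_simp

lemma sub (hf : ContDiff ℝ (⊤ : ℕ∞) f) (hg : ContDiff ℝ (⊤ : ℕ∞) g) :
    taylorSeries (fun x => f x - g x) = taylorSeries f - taylorSeries g := by
  ext n
  rw [map_sub, coeff_eq, coeff_eq, coeff_eq, iteratedDeriv_fun_sub, sub_div]
  · exact (hf.of_le (mod_cast le_top)).contDiffAt
  · exact (hg.of_le (mod_cast le_top)).contDiffAt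

lemma sum {ι : Type*} {s : Finset ι} {f : ι → ℝ → ℝ}
    (hf : ∀ i ∈ s, ContDiff ℝ (⊤ : ℕ∞) (f i)) :
    taylorSeries (fun x => ∑ i ∈ s, f i x) = ∑ i ∈ s, taylorSeries (f i) := by
  ext n
  rw [map_sum, coeff_eq, iteratedDeriv_fun_sum, Finset.sum_div]
  · simp
  · exact fun i hi => ((hf i hi).of_le (mod_cast le_top)).contDiffAt

lemma mul (hf : ContDiff ℝ (⊤ : ℕ∞) f) (hg : ContDiff ℝ (⊤ : ℕ∞) g) :
    taylorSeries (fun x => f x * g x) = taylorSeries f * taylorSeries g := by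
  ext n
  rw [coeff_eq, iteratedDeriv_fun_mul (hf.of_le (mod_cast le_top)).contDiffAt
    (hg.of_le (mod_cast le_top)).contDiffAt, coeff_mul,
    Finset.Nat.sum_antidiagonal_eq_sum_range_succ_mk, Finset.sum_div]
  refine Finset.sum_congr rfl fun i hi => ?_
  have hi : i ≤ n := Nat.lt_succ_iff.mp (Finset.mem_range.mp hi)
  rw [coeff_eq, coeff_eq, Nat.cast_choose ℝ hi]
  have h1 : (n.factorial : ℝ) ≠ 0 := by positivity
  have h2 : (i.factorial : ℝ) ≠ 0 := by positivity
  have h3 : ((n - i).factorial : ℝ) ≠ 0 := by positivity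
  field_simp

lemma pow (hf : ContDiff ℝ (⊤ : ℕ∞) f) (k : ℕ) :
    taylorSeries (fun x => f x ^ k) = taylorSeries f ^ k := by
  induction k with
  | zero => simpa using const 1
  | succ k ih =>
    simp only [pow_succ]
    rw [mul (hf.pow k) hf, ih]

lemma id : taylorSeries (fun x => x) = X := by
  refine derivative.ext ?_ ?_
  · rw [← deriv, derivative_X, deriv_id'', const, map_one]
  · rw [← coeff_zero_eq_constantCoeff_apply, coeff_eq]
    simp

/-- Composition with a smooth map fixing `0` does not decrease the order of vanishing at `0`. -/
lemma X_pow_dvd_comp (hg : ContDiff ℝ (⊤ : ℕ∞) g) (hg0 : g 0 = 0) (m : ℕ) :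
    ∀ f : ℝ → ℝ, ContDiff ℝ (⊤ : ℕ∞) f → X ^ m ∣ taylorSeries f →
      X ^ m ∣ taylorSeries (fun x => f (g x)) := by
  induction m with
  | zero => simp
  | succ m ih =>
    intro f hf hdvd
    have hf' : ContDiff ℝ (⊤ : ℕ∞) (_root_.deriv f) := (contDiff_infty_iff_deriv.mp hf).2
    have hg' : ContDiff ℝ (⊤ : ℕ∞) (_root_.deriv g) := (contDiff_infty_iff_deriv.mp hg).2
    rw [X_pow_dvd_iff] at hdvd
    have h1 : X ^ m ∣ taylorSeries (_root_.deriv f) := by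
      rw [deriv, X_pow_dvd_iff]
      intro k hk
      rw [coeff_derivative, hdvd _ (by lia), zero_mul]
    have hd : _root_.deriv (fun x => f (g x)) =
        fun x => _root_.deriv f (g x) * _root_.deriv g x := by
      funext x
      exact deriv_comp x ((hf.differentiable (by simp)) _) ((hg.differentiable (by simp)) _)
    have h2 : X ^ m ∣ d⁄dX ℝ (taylorSeries fun x => f (g x)) := by
      rw [← deriv, hd, mul (f := fun x => _root_.deriv f (g x)) (hf'.comp hg) hg']
      exact (ih _ hf' h1).mul_right _
    rw [X_pow_dvd_iff] at h2 ⊢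
    rintro (_ | k) hk
    · simpa [hg0] using hdvd 0 hk
    · have := h2 k (by lia)
      rw [coeff_derivative] at this
      exact (mul_eq_zero.mp this).resolve_right (by positivity)

/-- The Taylor series of a smooth left inverse is a formal left inverse of the Taylor series. -/
lemma X_pow_dvd_of_leftInverse (hf : ContDiff ℝ (⊤ : ℕ∞) f) (hg : ContDiff ℝ (⊤ : ℕ∞) g)
    (hg0 : g 0 = 0) (h : Function.LeftInverse f g) (m : ℕ) :
    X ^ m ∣ X - ∑ k ∈ Finset.range m,
      C (coeff k (taylorSeries f)) * taylorSeries g ^ k := by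
  set b : ℕ → ℝ := fun k => coeff k (taylorSeries f) with hb
  have hs (u : ℝ → ℝ) (hu : ContDiff ℝ (⊤ : ℕ∞) u) :
      taylorSeries (fun y => ∑ k ∈ Finset.range m, b k * u y ^ k) =
        ∑ k ∈ Finset.range m, C (b k) * taylorSeries u ^ k := by
    rw [sum fun k _ => contDiff_const.mul (hu.pow k)]
    refine Finset.sum_congr rfl fun k _ => ?_
    rw [mul contDiff_const (hu.pow k), const, pow hu]
  have hc (u : ℝ → ℝ) (hu : ContDiff ℝ (⊤ : ℕ∞) u) :
      ContDiff ℝ (⊤ : ℕ∞) (fun y => ∑ k ∈ Finset.range m, b k * u y ^ k) :=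
    ContDiff.sum fun k _ => contDiff_const.mul (hu.pow k)
  have key := X_pow_dvd_comp hg hg0 m
    (fun y => f y - ∑ k ∈ Finset.range m, b k * y ^ k) (hf.sub (hc _ contDiff_fun_id)) ?_
  · simp only [h _] at key
    rwa [sub contDiff_fun_id (hc g hg), hs g hg, id] at key
  · rw [sub hf (hc _ contDiff_fun_id), hs _ contDiff_fun_id, id, X_pow_dvd_iff]
    intro j hj
    simp only [map_sub, map_sum, coeff_C_mul, coeff_X_pow]
    simp [hb, hj]

end taylorSeries

namespace PowerSeries

/-- The logarithmic derivative term in Lagrange inversion has no residue. -/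
lemma coeff_derivative_X_mul_mul_inv_pow {K : Type*} [Field K] [CharZero K] {g : K⟦X⟧}
    (hg : constantCoeff g = 1) (j : ℕ) :
    coeff j (d⁄dX K (X * g) * g⁻¹ ^ (j + 1)) = if j = 0 then 1 else 0 := by
  have hgi : g * g⁻¹ = 1 := PowerSeries.mul_inv_cancel g (by simp [hg])
  have hd : d⁄dX K (X * g) = g + X * d⁄dX K g := by
    rw [Derivation.leibniz, derivative_X]
    simp only [smul_eq_mul]
    ring
  rcases j with _ | j
  · simp [hd, hg]
  · rw [if_neg j.succ_ne_zero]
    have h1 : d⁄dX K (g⁻¹ ^ (j + 1)) = -((j + 1 : ℕ) : K⟦X⟧) * (g⁻¹ ^ (j + 2) * d⁄dX K g) := by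
      rw [derivative_pow, derivative_inv']
      simp only [Nat.add_sub_cancel]
      ring
    have h2 : ((j + 1 : ℕ) : K⟦X⟧) * (d⁄dX K (X * g) * g⁻¹ ^ (j + 1 + 1)) =
        ((j + 1 : ℕ) : K⟦X⟧) * g⁻¹ ^ (j + 1) - X * d⁄dX K (g⁻¹ ^ (j + 1)) := by
      rw [h1, hd]
      linear_combination ((j + 1 : ℕ) : K⟦X⟧) * g⁻¹ ^ (j + 1) * hgi
    have h3 := congrArg (coeff (j + 1)) h2
    rw [← map_natCast (C : K →+* K⟦X⟧), coeff_C_mul, map_sub, coeff_C_mul, coeff_succ_X_mul,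
      coeff_derivative] at h3
    have h4 : ((j + 1 : ℕ) : K) ≠ 0 := Nat.cast_ne_zero.mpr j.succ_ne_zero
    refine (mul_eq_zero.mp (h3.trans ?_)).resolve_left h4
    push_cast
    ring

/-- Lagrange inversion formula. -/
lemma succ_mul_eq_coeff_inv_pow {K : Type*} [Field K] [CharZero K] {g : K⟦X⟧}
    (hg : constantCoeff g = 1) (b : ℕ → K) (n : ℕ)
    (h : X ^ (n + 2) ∣ X - ∑ k ∈ Finset.range (n + 2), C (b k) * (X * g) ^ k) :
    (n + 1) * b (n + 1) = coeff n (g⁻¹ ^ (n + 1)) := by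
  have hgi : g * g⁻¹ = 1 := PowerSeries.mul_inv_cancel g (by simp [hg])
  have hd : d⁄dX K (X - ∑ k ∈ Finset.range (n + 2), C (b k) * (X * g) ^ k) =
      1 - ∑ k ∈ Finset.range (n + 1),
        C (b (k + 1) * (k + 1)) * ((X * g) ^ k * d⁄dX K (X * g)) := by
    rw [map_sub, derivative_X, map_sum, Finset.sum_range_succ']
    simp only [Derivation.leibniz, derivative_C, derivative_pow, smul_eq_mul]
    simp only [Nat.add_sub_cancel, Nat.cast_add, map_mul, map_add, map_natCast, map_one,
      Nat.cast_zero, Nat.cast_one, mul_zero, zero_mul, add_zero]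
    congr 1
    refine Finset.sum_congr rfl fun k _ => ?_
    ring
  have h1 : X ^ (n + 1) ∣ (1 - ∑ k ∈ Finset.range (n + 1),
        C (b (k + 1) * (k + 1)) * ((X * g) ^ k * d⁄dX K (X * g))) * g⁻¹ ^ (n + 1) := by
    refine Dvd.dvd.mul_right ?_ _
    rw [← hd, X_pow_dvd_iff]
    intro k hk
    rw [coeff_derivative, X_pow_dvd_iff.mp h _ (by lia), zero_mul]
  have h2 := X_pow_dvd_iff.mp h1 n n.lt_succ_self
  rw [sub_mul, one_mul, map_sub, sub_eq_zero, Finset.sum_mul, map_sum] at h2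
  rw [h2, Finset.sum_eq_single_of_mem n (by simp)]
  all_goals
    have h3 (k : ℕ) (hk : k ≤ n) : coeff n (C (b (k + 1) * (k + 1)) *
        ((X * g) ^ k * d⁄dX K (X * g)) * g⁻¹ ^ (n + 1)) =
          b (k + 1) * (k + 1) * if n - k = 0 then 1 else 0 := by
      obtain ⟨j, rfl⟩ := Nat.exists_eq_add_of_le hk
      rw [← coeff_derivative_X_mul_mul_inv_pow hg, Nat.add_sub_cancel_left, ← coeff_C_mul,
        add_comm k j, ← coeff_X_pow_mul _ k j]
      refine congrArg (coeff (j + k)) ?_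
      have h4 : g ^ k * g⁻¹ ^ k = 1 := by rw [← mul_pow, hgi, one_pow]
      rw [mul_pow]
      linear_combination C (b (k + 1) * (k + 1)) * X ^ k * d⁄dX K (X * g) * g⁻¹ ^ (j + 1) * h4
  · rw [h3 n le_rfl]
    simp [mul_comm]
  · intro k hk hkn
    have : k < n + 1 := Finset.mem_range.mp hk
    rw [h3 k (by lia), if_neg (by lia), mul_zero]

/-- Truncated negative binomial expansion. -/
lemma pow_succ_dvd_one_sub_pow_mul_sum_choose {R : Type*} [CommRing R] (t : R) (n d : ℕ) :
    t ^ (n + 1) ∣ (1 - t) ^ (d + 1) *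
      ∑ k ∈ Finset.range (n + 1), ((d + k).choose d : R) * t ^ k - 1 := by
  induction d with
  | zero =>
    simp only [zero_add, Nat.choose_zero_right, Nat.cast_one, one_mul, pow_one]
    rw [mul_neg_geom_sum]
    exact ⟨-1, by ring⟩
  | succ d ih =>
    have hS (m : ℕ) :
        (1 - t) * ∑ k ∈ Finset.range (m + 1), ((d + 1 + k).choose (d + 1) : R) * t ^ k =
        ∑ k ∈ Finset.range (m + 1), ((d + k).choose d : R) * t ^ k -
          ((d + 1 + m).choose (d + 1) : R) * t ^ (m + 1) := by
      induction m with
      | zero => simp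
      | succ m ihm =>
        rw [Finset.sum_range_succ, mul_add, ihm, Finset.sum_range_succ _ (m + 1)]
        have : (d + 1 + (m + 1)).choose (d + 1) =
            (d + (m + 1)).choose d + (d + 1 + m).choose (d + 1) := by
          rw [show d + 1 + (m + 1) = d + (m + 1) + 1 by ring, Nat.choose_succ_succ']
          congr 2
          ring
        rw [this]
        push_cast
        ring
    rw [pow_succ (1 - t), mul_assoc, hS, mul_sub, sub_right_comm]
    exact dvd_sub ih (Dvd.intro_left _ (mul_assoc _ _ _))

lemma coeff_inv_pow_eq_sum {K : Type*} [Field K] {g u : K⟦X⟧} {n : ℕ}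
    (hu : X ∣ u) (hg : X ^ (n + 1) ∣ g - (1 + u)) :
    coeff n (g⁻¹ ^ (n + 1)) = ∑ k ∈ Finset.range (n + 1),
      (-1) ^ k * ((n + k).choose n : K) * coeff n (u ^ k) := by
  have hg0 : constantCoeff g = 1 := by
    have h1 : X ∣ g - (1 + u) := (dvd_pow_self X n.succ_ne_zero).trans hg
    rw [X_dvd_iff] at h1 hu
    simpa [hu, sub_eq_zero] using h1
  have hgi : g * g⁻¹ = 1 := PowerSeries.mul_inv_cancel g (by simp [hg0])
  set S : K⟦X⟧ := ∑ k ∈ Finset.range (n + 1), ((n + k).choose n : K⟦X⟧) * (-u) ^ k with hS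
  have h1 : X ^ (n + 1) ∣ (1 + u) ^ (n + 1) * S - 1 := by
    have := pow_succ_dvd_one_sub_pow_mul_sum_choose (-u) n n
    rw [sub_neg_eq_add] at this
    exact (pow_dvd_pow_of_dvd (hu.trans (dvd_neg.mpr dvd_rfl)) _).trans this
  have h2 : X ^ (n + 1) ∣ g ^ (n + 1) * S - 1 := by
    have := dvd_add ((hg.trans (sub_dvd_pow_sub_pow _ _ (n + 1))).mul_right S) h1
    convert this using 1
    ring
  have h3 : X ^ (n + 1) ∣ S - g⁻¹ ^ (n + 1) := by
    have h4 : g ^ (n + 1) * g⁻¹ ^ (n + 1) = 1 := by rw [← mul_pow, hgi, one_pow]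
    convert h2.mul_left (g⁻¹ ^ (n + 1)) using 1
    linear_combination -S * h4
  have h5 := X_pow_dvd_iff.mp h3 n n.lt_succ_self
  rw [map_sub, sub_eq_zero] at h5
  rw [← h5, hS, map_sum]
  refine Finset.sum_congr rfl fun k _ => ?_
  rw [neg_pow, ← coeff_C_mul]
  congr 1
  simp only [map_mul, map_pow, map_neg, map_one, map_natCast]
  ring

lemma coeff_sum_C_mul_X_pow_pow {K : Type*} [Field K] (a : ℕ → K) (n k : ℕ) :
    coeff n ((∑ i : Fin n, C (a i) * X ^ (i.1 + 1)) ^ k) =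
      ∑ c ∈ Finset.Nat.antidiagonalTuple n k,
        if ∑ i, (i.1 + 1) * c i = n then
          (Nat.multinomial Finset.univ c : K) * ∏ i : Fin n, a i ^ c i else 0 := by
  rw [Finset.sum_pow_eq_sum_piAntidiag, Finset.piAntidiag_univ_fin_eq_antidiagonalTuple, map_sum]
  refine Finset.sum_congr rfl fun c _ => ?_
  have : (Nat.multinomial Finset.univ c : K⟦X⟧) *
      ∏ i : Fin n, (C (a i) * X ^ (i.1 + 1)) ^ c i =
      C ((Nat.multinomial Finset.univ c : K) * ∏ i : Fin n, a i ^ c i) *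
        X ^ (∑ i, (i.1 + 1) * c i) := by
    simp only [mul_pow, Finset.prod_mul_distrib, ← pow_mul, Finset.prod_pow_eq_pow_sum,
      map_mul, map_natCast, map_prod, map_pow, mul_assoc]
  rw [this, coeff_C_mul, coeff_X_pow]
  simp [eq_comm]

end PowerSeries

lemma Finset.Nat.sum_antidiagonalTuple_succ {M : Type*} [AddCommMonoid M] (k n : ℕ)
    (F : (Fin (k + 1) → ℕ) → M) :
    ∑ c ∈ antidiagonalTuple (k + 1) n, F c =
      ∑ j ∈ Finset.range (n + 1), ∑ c ∈ antidiagonalTuple k j, F (Fin.cons (n - j) c) := by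
  rw [Finset.sum_sigma']
  refine Finset.sum_bij' (fun c _ => ⟨n - c 0, Fin.tail c⟩) (fun p _ => Fin.cons (n - p.1) p.2)
    ?_ ?_ ?_ ?_ ?_
  · intro c hc
    rw [mem_antidiagonalTuple, Fin.sum_univ_succ] at hc
    simp only [Finset.mem_sigma, Finset.mem_range, mem_antidiagonalTuple, Fin.tail]
    lia
  · rintro ⟨j, c⟩ h
    simp only [Finset.mem_sigma, Finset.mem_range, mem_antidiagonalTuple] at h
    simp only [mem_antidiagonalTuple, Fin.sum_univ_succ, Fin.cons_zero, Fin.cons_succ]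
    lia
  · intro c hc
    rw [mem_antidiagonalTuple, Fin.sum_univ_succ] at hc
    dsimp only
    rw [show n - (n - c 0) = c 0 by lia, Fin.cons_self_tail]
  · rintro ⟨j, c⟩ h
    simp only [Finset.mem_sigma, Finset.mem_range] at h
    simp only [Fin.cons_zero, Fin.tail_cons]
    rw [show n - (n - j) = j by lia]
  · intro c hc
    rw [mem_antidiagonalTuple, Fin.sum_univ_succ] at hc
    dsimp only
    rw [show n - (n - c 0) = c 0 by lia, Fin.cons_self_tail]

/-- Antipode formula for the Faà di Bruno Hopf algebra, realized analytically:
for `φ ∈ G₂` with inverse `ψ`, and `a_k(φ) = φ⁽ᵏ⁾(0)/k!`,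
`a_{n+1}(φ⁻¹) = Σ_{(c₁,…,c_{n+1}) ∈ Λ} (-1)^{n-c₁} ((2n-c₁)! c₁!)/((n+1)! c₁!⋯c_{n+1}!)
  a₁(φ)^{c₁}⋯a_{n+1}(φ)^{c_{n+1}}`, where `Λ` consists of the `(c₁,…,c_{n+1}) ∈ ℕ^{n+1}`
with `Σ c_j = n` and `Σ j c_j = 2n`. Here `c : Fin (n+1) → ℕ` encodes `c_j = c ⟨j-1⟩`. -/
theorem stmt9 (φ ψ : ℝ → ℝ) (hφ : IsOPDiffeo φ) (hφ0 : φ 0 = 0) (hφ1 : deriv φ 0 = 1)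
    (hψl : Function.LeftInverse ψ φ) (hψr : Function.RightInverse ψ φ)
    (n : ℕ) (hn : 1 ≤ n) :
    iteratedDeriv (n + 1) ψ 0 / (((n + 1).factorial : ℕ) : ℝ) =
      ∑ c ∈ (Finset.Nat.antidiagonalTuple (n + 1) n).filter
          (fun c => ∑ i, (i.1 + 1) * c i = 2 * n),
        ((-1 : ℝ) ^ (n - c 0) *
            (((2 * n - c 0).factorial : ℝ) * ((c 0).factorial : ℝ)) /
              ((((n + 1).factorial : ℕ) : ℝ) * ∏ i, ((c i).factorial : ℝ))) *
          ∏ i, (iteratedDeriv (i.1 + 1) φ 0 / (((i.1 + 1).factorial : ℕ) : ℝ)) ^ c i := by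
  obtain ⟨hφs, ⟨Ψ, hΨ, hΨl, -⟩, -⟩ := hφ
  have hψ : ψ = Ψ := by
    funext y
    rw [← hψr y, hψl, hΨl]
  rw [← hψ] at hΨ
  set a : ℕ → ℝ := fun k => iteratedDeriv k φ 0 / (k.factorial : ℝ) with ha
  have ha1 : a 1 = 1 := by simp [ha, hφ1]
  set g : PowerSeries ℝ := PowerSeries.mk fun k => a (k + 1) with hg
  have hT : taylorSeries φ = PowerSeries.X * g := by
    ext k
    cases k with
    | zero => simpa using hφ0
    | succ k => simp [hg, ha, PowerSeries.coeff_succ_X_mul]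
  have hg0 : PowerSeries.constantCoeff g = 1 := by
    simpa [hg, ← PowerSeries.coeff_zero_eq_constantCoeff_apply] using ha1
  set u : PowerSeries ℝ :=
    ∑ i : Fin n, PowerSeries.C (a (i + 2)) * PowerSeries.X ^ (i.1 + 1) with hu
  have hXu : PowerSeries.X ∣ u :=
    Finset.dvd_sum fun i _ => (dvd_pow_self _ i.1.succ_ne_zero).mul_left _
  have hgu : PowerSeries.X ^ (n + 1) ∣ g - (1 + u) := by
    rw [PowerSeries.X_pow_dvd_iff]
    rintro (_ | k) hk
    · simp [hg0, PowerSeries.X_dvd_iff.mp hXu]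
    · have hk' : k < n := by lia
      rw [hu, Fin.sum_univ_eq_sum_range
        (fun i => PowerSeries.C (a (i + 2)) * PowerSeries.X ^ (i + 1) : ℕ → PowerSeries ℝ)]
      simp [hg, PowerSeries.coeff_X_pow, PowerSeries.coeff_one, hk']
  have hL := taylorSeries.X_pow_dvd_of_leftInverse hΨ hφs hφ0 hψl (n + 2)
  rw [hT] at hL
  have hmain := PowerSeries.succ_mul_eq_coeff_inv_pow hg0
    (fun k => PowerSeries.coeff k (taylorSeries ψ)) n hL
  rw [PowerSeries.coeff_inv_pow_eq_sum hXu hgu, taylorSeries.coeff_eq] at hmain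
  have hn1 : (n + 1 : ℝ) ≠ 0 := by positivity
  rw [← mul_right_inj' hn1, hmain, Finset.sum_filter, Finset.Nat.sum_antidiagonalTuple_succ,
    Finset.mul_sum]
  refine Finset.sum_congr rfl fun k hk => ?_
  have hk : k ≤ n := Nat.lt_succ_iff.mp (Finset.mem_range.mp hk)
  rw [hu, PowerSeries.coeff_sum_C_mul_X_pow_pow (fun i => a (i + 2)), Finset.mul_sum,
    Finset.mul_sum]
  refine Finset.sum_congr rfl fun c hc => ?_
  rw [Finset.Nat.mem_antidiagonalTuple] at hc
  have hw : ∑ i : Fin (n + 1), (i.1 + 1) * (Fin.cons (n - k) c : Fin (n + 1) → ℕ) i =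
      n + ∑ i, (i.1 + 1) * c i := by
    have : ∑ i : Fin n, (i.1 + 1 + 1) * c i = ∑ i, (i.1 + 1) * c i + ∑ i, c i := by
      rw [← Finset.sum_add_distrib]
      exact Finset.sum_congr rfl fun i _ => by ring
    simp only [Fin.sum_univ_succ, Fin.cons_zero, Fin.cons_succ, Fin.val_zero, Fin.val_succ, this]
    lia
  rw [hw]
  by_cases hcn : ∑ i, (i.1 + 1) * c i = n
  · rw [if_pos hcn, if_pos (by lia), Fin.prod_univ_succ, Fin.prod_univ_succ]
    simp only [Fin.cons_zero, Fin.cons_succ, Fin.val_zero, Fin.val_succ]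
    have e1 : n - (n - k) = k := by lia
    have e2 : 2 * n - (n - k) = n + k := by lia
    have e3 : iteratedDeriv (0 + 1) φ 0 / ((0 + 1).factorial : ℝ) = 1 := ha1
    have hm : (∏ i, ((c i).factorial : ℝ)) * Nat.multinomial Finset.univ c = k.factorial := by
      have := Nat.multinomial_spec Finset.univ c
      rw [hc] at this
      exact_mod_cast this
    have hch : ((n + k).choose n : ℝ) * n.factorial * k.factorial = (n + k).factorial := by
      rw [Nat.choose_symm_add]
      exact_mod_cast Nat.add_choose_mul_factorial_mul_factorial n k
    have hp : (∏ i, ((c i).factorial : ℝ)) ≠ 0 :=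
      Finset.prod_ne_zero_iff.mpr fun i _ => by positivity
    have hf1 : ((n - k).factorial : ℝ) ≠ 0 := by positivity
    have hf2 : (n.factorial : ℝ) ≠ 0 := by positivity
    rw [e1, e2, e3, one_pow, one_mul, ← hch, ← hm, Nat.factorial_succ]
    push_cast
    field_simp
    rfl
  · rw [if_neg hcn, if_neg (by lia), mul_zero, mul_zero]
end

section
/- Let k be a field, and let A and H be Hopf algebras over k forming a left-right bicrossproduct datum: A is a left H-module algebra via ▷, H is a right A-comodule coalgebra via ∇ : H → H ⊗ A (written ∇(h) = h⁽¹⁾ ⊗ h⁽²⁾), and the bicrossproduct compatibility conditions hold (Δ(h ▷ a) = h₍₁₎⁽¹⁾ ▷ a₍₁₎ ⊗ h₍₁₎⁽²⁾(h₍₂₎ ▷ a₍₂₎); ∇(gh) = g₍₁₎⁽¹⁾h⁽¹⁾ ⊗ g₍₁₎⁽²⁾(g₍₂₎ ▷ h⁽²⁾); h₍₂₎⁽¹⁾ ⊗ (h₍₁₎ ▷ a)h₍₂₎⁽²⁾ = h₍₁₎⁽¹⁾ ⊗ h₍₁₎⁽²⁾(h₍₂₎ ▷ a); ε(h ▷ a)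 = ε(h)ε(a); ∇(1) = 1 ⊗ 1). Then the antipode S_A of A satisfies, for all h ∈ H and a ∈ A: S_A(h ▷ a) = (h⁽¹⁾ ▷ S_A(a))·S_A(h⁽²⁾). -/
open scoped TensorProduct

noncomputable section

/-- The reshuffling map `((m₁ ⊗ m₂) ⊗ x) ⊗ (y ⊗ z) ↦ (m₁ ⊗ y) ⊗ (m₂ ⊗ (x ⊗ z))`,
used to express Sweedler-notation formulas as compositions of linear maps. -/
def midShuffle (k : Type*) [CommRing k] (M₁ M₂ X Y Z : Type*)
    [AddCommGroup M₁] [Module k M₁] [AddCommGroup M₂] [Module k M₂]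
    [AddCommGroup X] [Module k X] [AddCommGroup Y] [Module k Y]
    [AddCommGroup Z] [Module k Z] :
    ((M₁ ⊗[k] M₂) ⊗[k] X) ⊗[k] (Y ⊗[k] Z) →ₗ[k]
      (M₁ ⊗[k] Y) ⊗[k] (M₂ ⊗[k] (X ⊗[k] Z)) :=
  (TensorProduct.assoc k (M₁ ⊗[k] Y) M₂ (X ⊗[k] Z)).toLinearMap ∘ₗ
  (TensorProduct.map
      ((TensorProduct.assoc k M₁ Y M₂).symm.toLinearMap ∘ₗ
        (TensorProduct.map LinearMap.id (TensorProduct.comm k M₂ Y).toLinearMap) ∘ₗ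
        (TensorProduct.assoc k M₁ M₂ Y).toLinearMap)
      LinearMap.id) ∘ₗ
  (TensorProduct.tensorTensorTensorComm k (M₁ ⊗[k] M₂) X Y Z).toLinearMap

open WithConv Coalgebra HopfAlgebra in
/-- If `act` is a measuring, then `h ⊗ a ↦ h ▷ S(a)` is a right convolution inverse of
`h ⊗ a ↦ h ▷ a`. -/
theorem lift_act_convMul_lift_act_antipode {k A H : Type*} [CommRing k] [Ring A] [AddCommGroup H]
    [HopfAlgebra k A] [Module k H] [Coalgebra k H] (act : H →ₗ[k] A →ₗ[k] A)
    (hact_algmul : ∀ (h : H) (a b : A),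
      act h (a * b) = LinearMap.mul' k A (TensorProduct.map (act.flip a) (act.flip b) (comul h)))
    (hact_algone : ∀ h : H, act h (1 : A) = counit (R := k) h • (1 : A)) :
    toConv (TensorProduct.lift act) *
      toConv (TensorProduct.lift (act.compl₂ (antipode k (A := A)))) = 1 := by
  ext h a
  have key : ∀ y : A ⊗[k] A,
      LinearMap.mul' k A (TensorProduct.map (TensorProduct.lift act)
        (TensorProduct.lift (act.compl₂ (antipode k (A := A))))
        (TensorProduct.tensorTensorTensorComm k H H A A (comul h ⊗ₜ[k] y))) =
      act h (LinearMap.mul' k A ((antipode k).lTensor A y)) := by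
    intro y
    induction y with
    | zero => simp
    | add y z hy hz => simp only [TensorProduct.tmul_add, map_add, hy, hz]
    | tmul b c =>
      simp only [LinearMap.lTensor_tmul, LinearMap.mul'_apply, hact_algmul]
      generalize (comul h : H ⊗[k] H) = x
      induction x with
      | zero => simp
      | add y z hy hz => simp only [TensorProduct.add_tmul, map_add, hy, hz]
      | tmul g h => simp
  have := key (comul a)
  rw [mul_antipode_lTensor_comul_apply, Algebra.algebraMap_eq_smul_one, map_smul,
    hact_algone] at this
  simpa [Algebra.algebraMap_eq_smul_one, TensorProduct.AlgebraTensorModule.tensorTensorTensorComm_eq,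
    mul_smul] using this

/-- The map `h ⊗ a ↦ S(h⁽¹⁾ ▷ a) h⁽²⁾`. -/
def antipodeActMul {k A H : Type*} [CommRing k] [Ring A] [AddCommGroup H]
    [HopfAlgebra k A] [Module k H] (act : H →ₗ[k] A →ₗ[k] A) (nab : H →ₗ[k] H ⊗[k] A) :
    H ⊗[k] A →ₗ[k] A :=
  LinearMap.mul' k A ∘ₗ
    (HopfAlgebra.antipode k ∘ₗ TensorProduct.lift act).rTensor A ∘ₗ
    (TensorProduct.rightComm k H A A).toLinearMap ∘ₗ nab.rTensor A

theorem antipodeActMul_tmul {k A H : Type*} [CommRing k] [Ring A] [AddCommGroup H]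
    [HopfAlgebra k A] [Module k H] (act : H →ₗ[k] A →ₗ[k] A) (nab : H →ₗ[k] H ⊗[k] A)
    (h : H) (a : A) :
    antipodeActMul act nab (h ⊗ₜ[k] a) =
      LinearMap.mul' k A ((HopfAlgebra.antipode k ∘ₗ act.flip a).rTensor A (nab h)) := by
  simp only [antipodeActMul, LinearMap.comp_apply, LinearMap.rTensor_tmul]
  induction nab h with
  | zero => simp
  | add y z hy hz => simp only [TensorProduct.add_tmul, map_add, hy, hz]
  | tmul g b => simp

open WithConv Coalgebra HopfAlgebra in
/-- Compatibility of `Δ` with the action makes `h ⊗ a ↦ S(h⁽¹⁾ ▷ a) h⁽²⁾` a left convolution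
inverse of `h ⊗ a ↦ h ▷ a`. -/
theorem antipodeActMul_convMul_lift_act {k A H : Type*} [CommRing k] [Ring A] [AddCommGroup H]
    [HopfAlgebra k A] [Module k H] [Coalgebra k H]
    (act : H →ₗ[k] A →ₗ[k] A) (nab : H →ₗ[k] H ⊗[k] A)
    (hcompat_comul : ∀ (h : H) (a : A),
      comul (R := k) (act h a) =
        (TensorProduct.map (TensorProduct.lift act)
            ((LinearMap.mul' k A) ∘ₗ (TensorProduct.map LinearMap.id (TensorProduct.lift act))))
          ((midShuffle k H A H A A)
            ((TensorProduct.map (TensorProduct.map nab LinearMap.id) LinearMap.id)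
              (comul h ⊗ₜ[k] comul a))))
    (hcompat_counit : ∀ (h : H) (a : A),
      counit (R := k) (act h a) = counit (R := k) h * counit (R := k) a) :
    toConv (antipodeActMul act nab) * toConv (TensorProduct.lift act) = 1 := by
  ext h a
  have key : ∀ (x : H ⊗[k] H) (y : A ⊗[k] A),
      LinearMap.mul' k A (TensorProduct.map (antipodeActMul act nab) (TensorProduct.lift act)
        (TensorProduct.tensorTensorTensorComm k H H A A (x ⊗ₜ[k] y))) =
      LinearMap.mul' k A ((antipode k).rTensor A
        ((TensorProduct.map (TensorProduct.lift act)
            ((LinearMap.mul' k A) ∘ₗ (TensorProduct.map LinearMap.id (TensorProduct.lift act))))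
          ((midShuffle k H A H A A)
            ((TensorProduct.map (TensorProduct.map nab LinearMap.id) LinearMap.id)
              (x ⊗ₜ[k] y))))) := by
    intro x y
    induction x with
    | zero => simp
    | add x z hx hz => simp only [TensorProduct.add_tmul, map_add, hx, hz]
    | tmul g h =>
      induction y with
      | zero => simp
      | add y z hy hz => simp only [TensorProduct.tmul_add, map_add, hy, hz]
      | tmul b c =>
        simp only [TensorProduct.tensorTensorTensorComm_tmul, TensorProduct.map_tmul,
          antipodeActMul_tmul]
        induction nab g with
        | zero => simp
        | add y z hy hz => simp only [TensorProduct.add_tmul, map_add, hy, hz]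
        | tmul g d => simp [midShuffle, mul_assoc]
  have := key (comul h) (comul a)
  rw [← hcompat_comul, mul_antipode_rTensor_comul_apply, hcompat_counit,
    mul_comm] at this
  simpa [TensorProduct.AlgebraTensorModule.tensorTensorTensorComm_eq] using this

open Coalgebra HopfAlgebra in
/-- If `S(h⁽¹⁾ ▷ a) h⁽²⁾ = h ▷ S(a)` for all `h`, then `S(h ▷ a) = (h⁽¹⁾ ▷ S(a)) S(h⁽²⁾)`. Here
`f h` stands for `S(h ▷ a)`. -/
theorem eq_mul_antipode_of_coaction {k A H : Type*} [CommRing k] [Ring A] [AddCommGroup H]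
    [HopfAlgebra k A] [Module k H] (nab : H →ₗ[k] H ⊗[k] A)
    (hnab_counit : ∀ h : H, TensorProduct.rid k H
      (TensorProduct.map LinearMap.id (counit (R := k) (A := A)) (nab h)) = h)
    (hnab_coassoc : ∀ h : H,
      TensorProduct.assoc k H A A (TensorProduct.map nab LinearMap.id (nab h)) =
        TensorProduct.map LinearMap.id (comul (R := k)) (nab h))
    (f g : H →ₗ[k] A) (hfg : ∀ h, LinearMap.mul' k A (f.rTensor A (nab h)) = g h) (h : H) :
    f h = LinearMap.mul' k A (TensorProduct.map g (antipode k) (nab h)) := by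
  obtain rfl : LinearMap.mul' k A ∘ₗ f.rTensor A ∘ₗ nab = g := LinearMap.ext hfg
  let F : H ⊗[k] (A ⊗[k] A) →ₗ[k] A :=
    LinearMap.mul' k A ∘ₗ TensorProduct.map f (LinearMap.mul' k A ∘ₗ (antipode k).lTensor A)
  have hl : ∀ x : H ⊗[k] A,
      F (TensorProduct.assoc k H A A (TensorProduct.map nab LinearMap.id x)) =
        LinearMap.mul' k A
          (TensorProduct.map (LinearMap.mul' k A ∘ₗ f.rTensor A ∘ₗ nab) (antipode k) x) := by
    intro x
    induction x with
    | zero => simp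
    | add y z hy hz => simp only [map_add, hy, hz]
    | tmul h a =>
      simp only [TensorProduct.map_tmul, LinearMap.comp_apply]
      induction nab h with
      | zero => simp
      | add y z hy hz => simp only [TensorProduct.add_tmul, map_add, hy, hz]
      | tmul h b => simp [F, mul_assoc]
  have hr : ∀ x : H ⊗[k] A, F (TensorProduct.map LinearMap.id (comul (R := k)) x) =
      f (TensorProduct.rid k H (TensorProduct.map LinearMap.id (counit (R := k) (A := A)) x)) := by
    intro x
    induction x with
    | zero => simp
    | add y z hy hz => simp only [map_add, hy, hz]
    | tmul h a => simp [F, Algebra.algebraMap_eq_smul_one]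
  rw [← hl, hnab_coassoc, hr, hnab_counit]

/-- For a left-right bicrossproduct datum `(A, H, act, nab)` of Hopf algebras over a field,
the antipode of `A` satisfies `S_A(h ▷ a) = Σ (h⁽¹⁾ ▷ S_A(a)) ⬝ S_A(h⁽²⁾)`. -/
theorem stmt12 {k A H : Type*} [Field k] [Ring A] [Ring H]
    [HopfAlgebra k A] [HopfAlgebra k H]
    (act : H →ₗ[k] A →ₗ[k] A) (nab : H →ₗ[k] H ⊗[k] A)
    -- `A` is a left `H`-module algebra :
    (hact_mul : ∀ (g h : H) (a : A), act (g * h) a = act g (act h a))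
    (hact_one : ∀ a : A, act (1 : H) a = a)
    (hact_algmul : ∀ (h : H) (a b : A),
      act h (a * b) =
        (LinearMap.mul' k A)
          ((TensorProduct.map (act.flip a) (act.flip b)) (Coalgebra.comul h)))
    (hact_algone : ∀ h : H, act h (1 : A) = Coalgebra.counit (R := k) h • (1 : A))
    -- `nab` is a counital coassociative right `A`-comodule structure on `H` :
    (hnab_counit : ∀ h : H,
      (TensorProduct.rid k H)
        ((TensorProduct.map LinearMap.id (Coalgebra.counit (R := k) (A := A))) (nab h)) = h)
    (hnab_coassoc : ∀ h : H,
      (TensorProduct.assoc k H A A) ((TensorProduct.map nab LinearMap.id) (nab h)) =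
        (TensorProduct.map LinearMap.id (Coalgebra.comul (R := k))) (nab h))
    -- `H` is a right `A`-comodule coalgebra :
    (hnab_counitH : ∀ h : H,
      (TensorProduct.lid k A)
        ((TensorProduct.map (Coalgebra.counit (R := k) (A := H)) LinearMap.id) (nab h)) =
        Coalgebra.counit (R := k) h • (1 : A))
    (hnab_comulH : ∀ h : H,
      (TensorProduct.map (Coalgebra.comul (R := k) (A := H)) LinearMap.id) (nab h) =
        (TensorProduct.map LinearMap.id (LinearMap.mul' k A))
          ((TensorProduct.tensorTensorTensorComm k H A H A)
            ((TensorProduct.map nab nab) (Coalgebra.comul h))))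
    -- compatibility (i) : `Δ(h ▷ a) = Σ h₍₁₎⁽¹⁾ ▷ a₍₁₎ ⊗ h₍₁₎⁽²⁾ (h₍₂₎ ▷ a₍₂₎)` :
    (hcompat_comul : ∀ (h : H) (a : A),
      Coalgebra.comul (R := k) (act h a) =
        (TensorProduct.map (TensorProduct.lift act)
            ((LinearMap.mul' k A) ∘ₗ (TensorProduct.map LinearMap.id (TensorProduct.lift act))))
          ((midShuffle k H A H A A)
            ((TensorProduct.map (TensorProduct.map nab LinearMap.id) LinearMap.id)
              (Coalgebra.comul h ⊗ₜ[k] Coalgebra.comul a))))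
    -- compatibility (ii) : `∇(gh) = Σ g₍₁₎⁽¹⁾ h⁽¹⁾ ⊗ g₍₁₎⁽²⁾ (g₍₂₎ ▷ h⁽²⁾)` :
    (hcompat_nabmul : ∀ g h : H,
      nab (g * h) =
        (TensorProduct.map (LinearMap.mul' k H)
            ((LinearMap.mul' k A) ∘ₗ (TensorProduct.map LinearMap.id (TensorProduct.lift act))))
          ((midShuffle k H A H H A)
            ((TensorProduct.map (TensorProduct.map nab LinearMap.id) LinearMap.id)
              (Coalgebra.comul g ⊗ₜ[k] nab h))))
    -- compatibility (iii) :
    -- `Σ h₍₂₎⁽¹⁾ ⊗ (h₍₁₎ ▷ a) h₍₂₎⁽²⁾ = Σ h₍₁₎⁽¹⁾ ⊗ h₍₁₎⁽²⁾ (h₍₂₎ ▷ a)` :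
    (hcompat_mixed : ∀ (h : H) (a : A),
      (TensorProduct.map LinearMap.id (LinearMap.mul' k A))
          ((TensorProduct.assoc k H A A)
            ((TensorProduct.map (TensorProduct.comm k A H).toLinearMap LinearMap.id)
              ((TensorProduct.assoc k A H A).symm
                ((TensorProduct.map (act.flip a) nab) (Coalgebra.comul h))))) =
        (TensorProduct.map LinearMap.id (LinearMap.mul' k A))
          ((TensorProduct.assoc k H A A)
            ((TensorProduct.map nab (act.flip a)) (Coalgebra.comul h))))
    -- compatibility (iv) :
    (hcompat_counit : ∀ (h : H) (a : A),
      Coalgebra.counit (R := k) (act h a) =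
        Coalgebra.counit (R := k) h * Coalgebra.counit (R := k) a)
    (hnab_one : nab (1 : H) = (1 : H) ⊗ₜ[k] (1 : A)) :
    ∀ (h : H) (a : A),
      HopfAlgebra.antipode (R := k) (act h a) =
        (LinearMap.mul' k A)
          ((TensorProduct.map (act.flip (HopfAlgebra.antipode (R := k) a))
              (HopfAlgebra.antipode (R := k))) (nab h)) := by
  intro h a
  have hconv := left_inv_eq_right_inv
    (antipodeActMul_convMul_lift_act act nab hcompat_comul hcompat_counit)
    (lift_act_convMul_lift_act_antipode act hact_algmul hact_algone)
  refine eq_mul_antipode_of_coaction nab hnab_counit hnab_coassoc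
    (HopfAlgebra.antipode k ∘ₗ act.flip a) _ (fun g => ?_) h
  rw [← antipodeActMul_tmul, WithConv.toConv_injective hconv]
  simp

end
end
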